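/- Let Δ > 0 and let Q_Δ be the infinite midrise uniform quantizer with step size Δ. Let Y and D be real random variables on a probability space with D independent of Y, and suppose the characteristic function φ of the law of D satisfies φ(2πl/Δ) = 0 for every nonzero integer l. Define the quantization error E = Q_Δ(Y + D) − (Y + D). Then E is uniformly distributed on (−Δ/2, Δ/2] and E is independent of Y. -/

import Mathlib

open MeasureTheory ProbabilityTheory Real

/-- The infinite midrise uniform quantizer with step size `Δ`. -/
noncomputable def midriseQuantizer (Δ x : ℝ) : ℝ := Δ * ⌊x / Δ⌋ + Δ / 2

/-- The uniform probability measure on a set `s ⊆ ℝ`: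
`(volume s)⁻¹` times Lebesgue measure restricted to `s`. -/
noncomputable def uniformOnSet (s : Set ℝ) : Measure ℝ :=
  (volume s)⁻¹ • volume.restrict s

/-- The characteristic function of a probability measure on `ℝ`. -/
noncomputable def charFn (μ : Measure ℝ) (t : ℝ) : ℂ :=
  ∫ x, Complex.exp (Complex.I * (t : ℂ) * (x : ℂ)) ∂μ

/-- A finite measure on the circle is determined by its Fourier coefficients. -/
theorem AddCircle.measure_ext_of_integral_fourier {T : ℝ} [Fact (0 < T)]
    {μ ν : Measure (AddCircle T)} [IsFiniteMeasure μ] [IsFiniteMeasure ν]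
    (h : ∀ n : ℤ, ∫ x, fourier n x ∂μ = ∫ x, fourier n x ∂ν) : μ = ν := by
  have hint (ρ : Measure (AddCircle T)) [IsFiniteMeasure ρ] (f : C(AddCircle T, ℂ)) :
      Integrable f ρ :=
    (BoundedContinuousFunction.mkOfCompact f).integrable ρ
  have hspan : ∀ f ∈ Submodule.span ℂ (Set.range (fourier (T := T))),
      ∫ x, f x ∂μ = ∫ x, f x ∂ν := by
    intro f hf
    induction hf using Submodule.span_induction with
    | mem f hf =>
      obtain ⟨n, rfl⟩ := hf
      exact h n
    | zero => simp
    | add f g _ _ hf hg =>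
      simp only [ContinuousMap.add_apply]
      rw [integral_add (hint μ f) (hint μ g), integral_add (hint ν f) (hint ν g), hf, hg]
    | smul c f _ hf =>
      simp only [ContinuousMap.smul_apply]
      rw [integral_smul, integral_smul, hf]
  refine ext_of_forall_mem_subalgebra_integral_eq_of_polish (𝕜 := ℂ)
    (A := fourierSubalgebra.comap
      (BoundedContinuousFunction.toContinuousMapStarₐ ℂ)) ?_ ?_
  · intro x y hxy
    obtain ⟨_, ⟨f, hf, rfl⟩, hfxy⟩ := fourierSubalgebra_separatesPoints (T := T) hxy
    exact ⟨f, ⟨f, ⟨BoundedContinuousFunction.mkOfCompact f, hf, rfl⟩, rfl⟩, hfxy⟩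
  · intro g hg
    refine hspan g.toContinuousMap ?_
    rw [← fourierSubalgebra_coe]
    exact hg

/-- A finite measure on a half-open interval of length `T` is determined by its Fourier
coefficients. -/
theorem measure_ext_of_integral_exp_of_Ioc {a T : ℝ} (hT : 0 < T)
    {μ ν : Measure ℝ} [IsFiniteMeasure μ] [IsFiniteMeasure ν]
    (hμ : ∀ᵐ x ∂μ, x ∈ Set.Ioc a (a + T)) (hν : ∀ᵐ x ∂ν, x ∈ Set.Ioc a (a + T))
    (h : ∀ n : ℤ, ∫ x : ℝ, Complex.exp (2 * π * Complex.I * n * x / T) ∂μ =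
      ∫ x : ℝ, Complex.exp (2 * π * Complex.I * n * x / T) ∂ν) : μ = ν := by
  have : Fact (0 < T) := ⟨hT⟩
  have hmk : Measurable ((↑) : ℝ → AddCircle T) := AddCircle.measurable_mk'
  have hcircle : μ.map ((↑) : ℝ → AddCircle T) = ν.map ((↑) : ℝ → AddCircle T) := by
    refine AddCircle.measure_ext_of_integral_fourier fun n => ?_
    rw [integral_map hmk.aemeasurable (by fun_prop), integral_map hmk.aemeasurable (by fun_prop)]
    simpa only [fourier_coe_apply] using h n
  have hlift : Measurable fun q : AddCircle T => (AddCircle.measurableEquivIoc T a q : ℝ) :=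
    measurable_subtype_coe.comp (AddCircle.measurableEquivIoc T a).measurable
  have hrecover (ρ : Measure ℝ) (hρ : ∀ᵐ x ∂ρ, x ∈ Set.Ioc a (a + T)) :
      (ρ.map ((↑) : ℝ → AddCircle T)).map
        (fun q : AddCircle T => (AddCircle.measurableEquivIoc T a q : ℝ)) = ρ := by
    rw [Measure.map_map hlift hmk]
    conv_rhs => rw [← Measure.map_id (μ := ρ)]
    refine Measure.map_congr ?_
    filter_upwards [hρ] with x hx
    exact AddCircle.equivIoc_coe_of_mem hx
  rw [← hrecover μ hμ, ← hrecover ν hν, hcircle]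

theorem midriseQuantizer_sub_mem_Ioc {Δ : ℝ} (hΔ : 0 < Δ) (x : ℝ) :
    midriseQuantizer Δ x - x ∈ Set.Ioc (-(Δ / 2)) (Δ / 2) := by
  have h₁ := (le_div_iff₀ hΔ).1 (Int.floor_le (x / Δ))
  have h₂ := (div_lt_iff₀ hΔ).1 (Int.lt_floor_add_one (x / Δ))
  constructor <;> unfold midriseQuantizer <;> linarith

@[fun_prop]
theorem measurable_midriseQuantizer (Δ : ℝ) : Measurable (midriseQuantizer Δ) := by
  have : Measurable fun x : ℝ => (⌊x / Δ⌋ : ℝ) :=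
    (measurable_from_top (f := fun z : ℤ => (z : ℝ))).comp (by fun_prop)
  unfold midriseQuantizer
  fun_prop

theorem exp_midriseQuantizer_sub {Δ : ℝ} (hΔ : 0 < Δ) (n : ℤ) (x : ℝ) :
    Complex.exp (2 * π * Complex.I * n * ((midriseQuantizer Δ x - x : ℝ) : ℂ) / Δ) =
      Complex.exp (π * Complex.I * n) * Complex.exp (-(2 * π * Complex.I * n * x / Δ)) := by
  have hΔ' : (Δ : ℂ) ≠ 0 := mod_cast hΔ.ne'
  rw [← Complex.exp_add, Complex.exp_eq_exp_iff_exists_int]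
  refine ⟨n * ⌊x / Δ⌋, ?_⟩
  unfold midriseQuantizer
  push_cast
  field_simp
  ring

theorem isProbabilityMeasure_uniformOnSet_Ioc {Δ : ℝ} (hΔ : 0 < Δ) :
    IsProbabilityMeasure (uniformOnSet (Set.Ioc (-(Δ / 2)) (Δ / 2))) := by
  refine ⟨?_⟩
  rw [uniformOnSet, Measure.smul_apply, Measure.restrict_apply_univ, smul_eq_mul]
  refine ENNReal.inv_mul_cancel ?_ ?_ <;> simp [hΔ]

theorem integral_exp_uniformOnSet_Ioc {Δ : ℝ} (hΔ : 0 < Δ) {n : ℤ} (hn : n ≠ 0) :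
    ∫ x : ℝ, Complex.exp (2 * π * Complex.I * n * x / Δ)
      ∂uniformOnSet (Set.Ioc (-(Δ / 2)) (Δ / 2)) = 0 := by
  have hΔ' : (Δ : ℂ) ≠ 0 := mod_cast hΔ.ne'
  have hn' : (n : ℂ) ≠ 0 := mod_cast hn
  have hπ : (π : ℂ) ≠ 0 := mod_cast Real.pi_ne_zero
  have hc : 2 * π * Complex.I * n / Δ ≠ 0 := by simp [hΔ', hn', hπ]
  rw [uniformOnSet, integral_smul_measure, ← intervalIntegral.integral_of_le (by linarith)]
  have hcomm (x : ℝ) : 2 * π * Complex.I * n * x / Δ = 2 * π * Complex.I * n / Δ * x := by ring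
  simp only [hcomm]
  rw [integral_exp_mul_complex hc, sub_eq_zero.2, zero_div, smul_zero]
  rw [Complex.exp_eq_exp_iff_exists_int]
  refine ⟨n, ?_⟩
  push_cast
  field_simp
  ring

/-- Under Schuchman's condition the quantization error is uniform on every event that depends
only on the signal. -/
theorem map_restrict_quantizationError
    {Ω : Type*} [MeasurableSpace Ω] {P : Measure Ω} [IsProbabilityMeasure P]
    {Δ : ℝ} (hΔ : 0 < Δ) {Y D : Ω → ℝ} (hY : Measurable Y) (hD : Measurable D)
    (hindep : IndepFun D Y P)
    (hchar : ∀ l : ℤ, l ≠ 0 → charFn (P.map D) (2 * π * (l : ℝ) / Δ) = 0)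
    {A : Set ℝ} (hA : MeasurableSet A) :
    (P.restrict (Y ⁻¹' A)).map (fun ω => midriseQuantizer Δ (Y ω + D ω) - (Y ω + D ω)) =
      P (Y ⁻¹' A) • uniformOnSet (Set.Ioc (-(Δ / 2)) (Δ / 2)) := by
  have := isProbabilityMeasure_uniformOnSet_Ioc hΔ
  have hmeas : Measurable fun ω => midriseQuantizer Δ (Y ω + D ω) - (Y ω + D ω) := by fun_prop
  have hend : -(Δ / 2) + Δ = Δ / 2 := by ring
  have := Measure.smul_finite (uniformOnSet (Set.Ioc (-(Δ / 2)) (Δ / 2)))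
    (measure_ne_top P (Y ⁻¹' A))
  refine measure_ext_of_integral_exp_of_Ioc (a := -(Δ / 2)) hΔ ?_ ?_ fun n => ?_
  · rw [hend]
    exact (ae_map_iff hmeas.aemeasurable measurableSet_Ioc).2
      (ae_of_all _ fun ω => midriseQuantizer_sub_mem_Ioc hΔ _)
  · rw [hend]
    refine Measure.ae_smul_measure ?_ _
    exact Measure.ae_smul_measure (ae_restrict_mem measurableSet_Ioc) _
  · rw [integral_smul_measure, integral_map hmeas.aemeasurable (by fun_prop)]
    rcases eq_or_ne n 0 with rfl | hn
    · simp [Measure.real]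
    rw [integral_exp_uniformOnSet_Ioc hΔ hn, smul_zero]
    simp only [exp_midriseQuantizer_sub hΔ]
    rw [integral_const_mul, ← integral_indicator (hY hA)]
    let f : ℝ → ℂ := fun x => Complex.exp (-(2 * π * Complex.I * n * x / Δ))
    have hf : Measurable f := by fun_prop
    have hg : Measurable (A.indicator f) := hf.indicator hA
    have hDf : ∫ ω, f (D ω) ∂P = 0 := by
      have h := hchar (-n) (neg_ne_zero.2 hn)
      rw [charFn, integral_map hD.aemeasurable (by fun_prop)] at h
      rw [← h]
      refine integral_congr_ae (ae_of_all _ fun ω => ?_)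
      simp only [f]
      congr 1
      push_cast
      ring
    have hsplit : (Y ⁻¹' A).indicator
        (fun ω => Complex.exp (-(2 * π * Complex.I * n * ((Y ω + D ω : ℝ) : ℂ) / Δ))) =
        fun ω => f (D ω) * A.indicator f (Y ω) := by
      funext ω
      by_cases hω : Y ω ∈ A
      · rw [Set.indicator_of_mem (show ω ∈ Y ⁻¹' A from hω), Set.indicator_of_mem hω,
          ← Complex.exp_add]
        congr 1
        push_cast
        ring
      · rw [Set.indicator_of_notMem (show ω ∉ Y ⁻¹' A from hω), Set.indicator_of_notMem hω,
          mul_zero]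
    have hprod := (hindep.comp hf hg).integral_fun_mul_eq_mul_integral
      (hf.comp hD).aestronglyMeasurable (hg.comp hY).aestronglyMeasurable
    simp only [Function.comp_apply] at hprod
    rw [hsplit, hprod, hDf, zero_mul, mul_zero]

/-- Schuchman's condition: if the dither `D` is independent of the signal `Y` and the
characteristic function `φ` of the law of `D` satisfies `φ(2πl/Δ) = 0` for every nonzero
integer `l`, then the quantization error `E = Q_Δ(Y + D) - (Y + D)` is uniform on
`(-Δ/2, Δ/2]` and independent of `Y`. -/
theorem quantizationError_uniform_and_indep_of_charFun
    {Ω : Type*} [MeasurableSpace Ω] (P : Measure Ω) [IsProbabilityMeasure P]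
    (Δ : ℝ) (hΔ : 0 < Δ) (Y D : Ω → ℝ) (hY : Measurable Y) (hD : Measurable D)
    (hindep : IndepFun D Y P)
    (hchar : ∀ l : ℤ, l ≠ 0 → charFn (P.map D) (2 * π * (l : ℝ) / Δ) = 0)
    (E : Ω → ℝ) (hE : ∀ ω, E ω = midriseQuantizer Δ (Y ω + D ω) - (Y ω + D ω)) :
    P.map E = uniformOnSet (Set.Ioc (-(Δ / 2)) (Δ / 2)) ∧ IndepFun E Y P := by
  obtain rfl : E = fun ω => midriseQuantizer Δ (Y ω + D ω) - (Y ω + D ω) := funext hE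
  have hcond {A : Set ℝ} (hA : MeasurableSet A) :=
    map_restrict_quantizationError hΔ hY hD hindep hchar hA
  have hmeas : Measurable fun ω => midriseQuantizer Δ (Y ω + D ω) - (Y ω + D ω) := by fun_prop
  have hlaw := hcond MeasurableSet.univ
  rw [Set.preimage_univ, Measure.restrict_univ, measure_univ, one_smul] at hlaw
  refine ⟨hlaw, indepFun_iff_measure_inter_preimage_eq_mul.2 fun B A hB hA => ?_⟩
  have h := congrArg (fun ρ : Measure ℝ => ρ B) (hcond hA)
  rw [← hlaw] at h
  simp only [Measure.smul_apply, smul_eq_mul] at h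
  rw [Measure.map_apply hmeas hB, Measure.map_apply hmeas hB,
    Measure.restrict_apply (hmeas hB)] at h
  rw [h, mul_comm]
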